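/- arXiv:2211.07857 — 6 statements merged into one kernel-verified Lean document; each statement's English description precedes it below -/
import Mathlib

section
/- Let X be a complete CUB metric space, i.e. a complete metric space admitting a unique convex bicombing. Then every finite group G of surjective isometries of X has a global fixed point, i.e. there exists x ∈ X with g(x) = x for every g ∈ G. -/
open Set

/-- A geodesic bicombing on a metric space: `σ x y` restricted to `[0,1]` is a
constant-speed geodesic from `x` to `y`. -/
def IsGeodesicBicombing {X : Type*} [MetricSpace X] (σ : X → X → ℝ → X) : Prop :=
  ∀ x y : X, σ x y 0 = x ∧ σ x y 1 = y ∧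
    ∀ s ∈ Icc (0:ℝ) 1, ∀ t ∈ Icc (0:ℝ) 1,
      dist (σ x y s) (σ x y t) = |s - t| * dist x y

/-- Reversibility of a bicombing. -/
def IsReversibleBicombing {X : Type*} [MetricSpace X] (σ : X → X → ℝ → X) : Prop :=
  ∀ x y : X, ∀ t ∈ Icc (0:ℝ) 1, σ x y t = σ y x (1 - t)

/-- Consistency of a bicombing. -/
def IsConsistentBicombing {X : Type*} [MetricSpace X] (σ : X → X → ℝ → X) : Prop :=
  ∀ x y : X, ∀ s ∈ Icc (0:ℝ) 1, ∀ t ∈ Icc (0:ℝ) 1, σ x y (s * t) = σ x (σ x y t) s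

/-- Conicality of a bicombing. -/
def IsConicalBicombing {X : Type*} [MetricSpace X] (σ : X → X → ℝ → X) : Prop :=
  ∀ x y x' y' : X, ∀ t ∈ Icc (0:ℝ) 1,
    dist (σ x y t) (σ x' y' t) ≤ (1 - t) * dist x x' + t * dist y y'

/-- Convexity of a bicombing: distances between combing lines are convex in `t` on `[0,1]`. -/
def IsConvexBicombingMap {X : Type*} [MetricSpace X] (σ : X → X → ℝ → X) : Prop :=
  ∀ x y x' y' : X, ConvexOn ℝ (Icc (0:ℝ) 1) (fun t => dist (σ x y t) (σ x' y' t))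

/-- A convex bicombing: a convex, consistent, reversible geodesic bicombing. -/
def IsConvexBicombing {X : Type*} [MetricSpace X] (σ : X → X → ℝ → X) : Prop :=
  IsGeodesicBicombing σ ∧ IsReversibleBicombing σ ∧ IsConsistentBicombing σ ∧
    IsConvexBicombingMap σ

open Filter Topology

/-- A barycenter map on `n`-tuples for a binary midpoint operation `m`: it is invariant under
permutations, idempotent, averages distances, and commutes with the isometries preserving `m`. -/
structure IsBarycenter {X : Type*} [MetricSpace X] (m : X → X → X) {n : ℕ}
    (B : (Fin n → X) → X) : Prop where
  perm : ∀ (x : Fin n → X) (π : Equiv.Perm (Fin n)), B (x ∘ π) = B x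
  const : ∀ z : X, B (fun _ => z) = z
  dist_le : ∀ x y : Fin n → X, n * dist (B x) (B y) ≤ ∑ i, dist (x i) (y i)
  equivariant : ∀ g : X ≃ᵢ X, (∀ a b, g (m a b) = m (g a) (g b)) →
    ∀ x : Fin n → X, B (g ∘ x) = g (B x)

/-- Replace every entry of a tuple by the barycenter of the other entries. -/
def otherBarycenters {X : Type*} {n : ℕ} (B : (Fin n → X) → X) (x : Fin (n + 1) → X) :
    Fin (n + 1) → X :=
  fun i => B (x ∘ i.succAbove)

section Barycenter

variable {X : Type*} [MetricSpace X] {m : X → X → X} {n : ℕ} {B : (Fin n → X) → X}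

lemma exists_perm_comp_succAbove (π : Equiv.Perm (Fin (n + 1))) (i : Fin (n + 1)) :
    ∃ ρ : Equiv.Perm (Fin n), π ∘ i.succAbove = (π i).succAbove ∘ ρ := by
  refine ⟨(finSuccAboveEquiv i).trans ((π.subtypeEquiv fun a => by simp).trans
    (finSuccAboveEquiv (π i)).symm), ?_⟩
  funext k
  have h := congrArg Subtype.val ((finSuccAboveEquiv (π i)).apply_symm_apply
    ⟨π (i.succAbove k), by simp⟩)
  rw [finSuccAboveEquiv_apply] at h
  exact h.symm

lemma otherBarycenters_perm (hB : IsBarycenter m B) (x : Fin (n + 1) → X)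
    (π : Equiv.Perm (Fin (n + 1))) :
    otherBarycenters B (x ∘ π) = otherBarycenters B x ∘ π := by
  funext i
  obtain ⟨ρ, hρ⟩ := exists_perm_comp_succAbove π i
  simp only [otherBarycenters, Function.comp_apply, Function.comp_assoc, hρ]
  rw [← Function.comp_assoc, hB.perm]

lemma dist_otherBarycenters_self_le (hB : IsBarycenter m B) (hn : 0 < n) (x : Fin (n + 1) → X)
    {D : ℝ} (hD : ∀ i j, dist (x i) (x j) ≤ D) (i : Fin (n + 1)) :
    dist (x i) (otherBarycenters B x i) ≤ D := by
  have h := hB.dist_le (fun _ => x i) (x ∘ i.succAbove)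
  rw [hB.const] at h
  have h2 : ∑ k : Fin n, dist (x i) ((x ∘ i.succAbove) k) ≤ ∑ _k : Fin n, D :=
    Finset.sum_le_sum fun k _ => hD _ _
  simp only [Finset.sum_const, Finset.card_univ, Fintype.card_fin, nsmul_eq_mul] at h2
  exact le_of_mul_le_mul_left (h.trans h2) (by exact_mod_cast hn)

lemma dist_otherBarycenters_le (hB : IsBarycenter m B) (x : Fin (n + 1) → X)
    (i j : Fin (n + 1)) :
    n * dist (otherBarycenters B x i) (otherBarycenters B x j) ≤ dist (x i) (x j) := by
  rcases eq_or_ne i j with rfl | hij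
  · simp
  have hj : otherBarycenters B x j = B ((x ∘ Equiv.swap i j) ∘ i.succAbove) := by
    have := congrFun (otherBarycenters_perm hB x (Equiv.swap i j)) i
    simpa [otherBarycenters] using this.symm
  rw [hj]
  refine (hB.dist_le _ _).trans ?_
  obtain ⟨k, hk⟩ := Fin.exists_succAbove_eq hij.symm
  rw [Finset.sum_eq_single k]
  · simp [hk, dist_comm]
  · intro l _ hl
    have h1 : i.succAbove l ≠ j := fun h => hl (Fin.succAbove_right_injective (h.trans hk.symm))
    simp [Equiv.swap_apply_of_ne_of_ne (Fin.succAbove_ne i l) h1]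
  · simp

lemma sum_dist_otherBarycenters_le (hB : IsBarycenter m B) (hn : 0 < n)
    (x y : Fin (n + 1) → X) :
    ∑ i, dist (otherBarycenters B x i) (otherBarycenters B y i) ≤ ∑ i, dist (x i) (y i) := by
  have h : ∑ i, n * dist (otherBarycenters B x i) (otherBarycenters B y i) ≤
      ∑ i, (∑ j, dist (x j) (y j) - dist (x i) (y i)) := by
    refine Finset.sum_le_sum fun i _ => (hB.dist_le _ _).trans ?_
    rw [Fin.sum_univ_succAbove (fun j => dist (x j) (y j)) i]
    simp
  rw [← Finset.mul_sum, Finset.sum_sub_distrib] at h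
  simp only [Finset.sum_const, Finset.card_univ, Fintype.card_fin, nsmul_eq_mul] at h
  refine le_of_mul_le_mul_left (h.trans_eq ?_) (Nat.cast_pos.mpr hn)
  push_cast
  ring

lemma otherBarycenters_const (hB : IsBarycenter m B) (z : X) :
    otherBarycenters B (fun _ => z) = fun _ => z :=
  funext fun _ => hB.const z

lemma otherBarycenters_equivariant (hB : IsBarycenter m B) (g : X ≃ᵢ X)
    (hg : ∀ a b, g (m a b) = m (g a) (g b)) (x : Fin (n + 1) → X) :
    otherBarycenters B (g ∘ x) = g ∘ otherBarycenters B x :=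
  funext fun i => hB.equivariant g hg (x ∘ i.succAbove)

lemma dist_iterate_otherBarycenters_le (hB : IsBarycenter m B) (hn : 2 ≤ n)
    (x : Fin (n + 1) → X) {D : ℝ} (hD : ∀ i j, dist (x i) (x j) ≤ D) (k : ℕ)
    (i j : Fin (n + 1)) :
    dist ((otherBarycenters B)^[k] x i) ((otherBarycenters B)^[k] x j) ≤ D / 2 ^ k := by
  induction k generalizing i j with
  | zero => simpa using hD i j
  | succ k ih =>
    rw [Function.iterate_succ_apply', pow_succ, ← div_div, le_div_iff₀ two_pos]
    have hn' : (2 : ℝ) ≤ n := by exact_mod_cast hn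
    refine le_trans ?_ ((dist_otherBarycenters_le hB _ i j).trans (ih i j))
    rw [mul_comm]
    gcongr

lemma exists_tendsto_iterate_otherBarycenters [CompleteSpace X] (hB : IsBarycenter m B)
    (hn : 2 ≤ n) (x : Fin (n + 1) → X) :
    ∃ l, ∀ i, Tendsto (fun k => (otherBarycenters B)^[k] x i) atTop (𝓝 l) := by
  obtain ⟨D, hD⟩ : ∃ D, ∀ i j, dist (x i) (x j) ≤ D :=
    ⟨Metric.diam (range x), fun i j => Metric.dist_le_diam_of_mem
      (finite_range x).isBounded (mem_range_self i) (mem_range_self j)⟩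
  have hdiam := dist_iterate_otherBarycenters_le hB hn x hD
  have hcauchy : CauchySeq fun k => (otherBarycenters B)^[k] x 0 := by
    refine cauchySeq_of_le_geometric_two (C := 2 * D) fun k => ?_
    rw [Function.iterate_succ_apply']
    refine (dist_otherBarycenters_self_le hB (by omega) _ (hdiam k) 0).trans_eq ?_
    ring
  obtain ⟨l, hl⟩ := cauchySeq_tendsto_of_complete hcauchy
  refine ⟨l, fun i => hl.congr_dist ?_⟩
  refine squeeze_zero (fun _ => dist_nonneg) (fun k => hdiam k 0 i) ?_
  simpa [div_eq_mul_inv] using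
    (tendsto_pow_atTop_nhds_zero_of_lt_one (r := (2 : ℝ)⁻¹) (by norm_num) (by norm_num)).const_mul D

lemma IsBarycenter.exists_succ [CompleteSpace X] (hB : IsBarycenter m B) (hn : 2 ≤ n) :
    ∃ C : (Fin (n + 1) → X) → X, IsBarycenter m C := by
  choose C hC using exists_tendsto_iterate_otherBarycenters hB hn
  refine ⟨C, ?_, ?_, ?_, ?_⟩
  · intro x π
    have h (k : ℕ) : (otherBarycenters B)^[k] (x ∘ π) = (otherBarycenters B)^[k] x ∘ π :=
      ((show Function.Semiconj (· ∘ π) (otherBarycenters B) (otherBarycenters B) from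
        fun y => (otherBarycenters_perm hB y π).symm).iterate_right k x).symm
    refine tendsto_nhds_unique (hC (x ∘ π) 0) ?_
    simpa only [h, Function.comp_apply] using hC x (π 0)
  · intro z
    refine tendsto_nhds_unique (hC (fun _ => z) 0) ?_
    simp [Function.iterate_fixed (otherBarycenters_const hB z)]
  · intro x y
    have hmono (k : ℕ) : ∑ i, dist ((otherBarycenters B)^[k] x i) ((otherBarycenters B)^[k] y i) ≤
        ∑ i, dist (x i) (y i) := by
      induction k with
      | zero => simp
      | succ k ih =>
        simp only [Function.iterate_succ_apply']
        exact (sum_dist_otherBarycenters_le hB (by omega) _ _).trans ih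
    have hlim := tendsto_finsetSum Finset.univ
      fun i (_ : i ∈ Finset.univ) => (hC x i).dist (hC y i)
    simpa using le_of_tendsto' hlim hmono
  · intro g hg x
    have h (k : ℕ) : (otherBarycenters B)^[k] (g ∘ x) = g ∘ (otherBarycenters B)^[k] x :=
      ((show Function.Semiconj (g ∘ ·) (otherBarycenters B) (otherBarycenters B) from
        fun y => (otherBarycenters_equivariant hB g hg y).symm).iterate_right k x).symm
    refine tendsto_nhds_unique (hC (g ∘ x) 0) ?_
    simp only [h]
    exact (g.continuous.tendsto _).comp (hC x 0)

lemma isBarycenter_one (m : X → X → X) : IsBarycenter m fun x : Fin 1 → X => x 0 where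
  perm x π := by simp [Subsingleton.elim (π 0) 0]
  const _ := rfl
  dist_le x y := by simp
  equivariant _ _ _ := rfl

lemma isBarycenter_two (hcomm : ∀ a b, m a b = m b a) (hidem : ∀ a, m a a = a)
    (hdist : ∀ a b a' b', 2 * dist (m a b) (m a' b') ≤ dist a a' + dist b b') :
    IsBarycenter m fun x : Fin 2 → X => m (x 0) (x 1) where
  perm x π := by
    have hne : π 0 ≠ π 1 := π.injective.ne (by decide)
    have h : (π 0 = 0 ∧ π 1 = 1) ∨ (π 0 = 1 ∧ π 1 = 0) := by omega
    rcases h with ⟨h0, h1⟩ | ⟨h0, h1⟩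
    · simp [h0, h1]
    · simp [h0, h1, hcomm (x 1)]
  const := hidem
  dist_le x y := by simpa using hdist (x 0) (x 1) (y 0) (y 1)
  equivariant g hg x := (hg _ _).symm

lemma exists_isBarycenter [CompleteSpace X] (hcomm : ∀ a b, m a b = m b a)
    (hidem : ∀ a, m a a = a)
    (hdist : ∀ a b a' b', 2 * dist (m a b) (m a' b') ≤ dist a a' + dist b b') {n : ℕ}
    (hn : 1 ≤ n) : ∃ B : (Fin n → X) → X, IsBarycenter m B := by
  obtain rfl | hn2 : n = 1 ∨ 2 ≤ n := by omega
  · exact ⟨_, isBarycenter_one m⟩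
  clear hn
  induction n, hn2 using Nat.le_induction with
  | base => exact ⟨_, isBarycenter_two hcomm hidem hdist⟩
  | succ n hn ih =>
    obtain ⟨B, hB⟩ := ih
    exact hB.exists_succ hn

/-- The barycenter of an orbit is a fixed point. -/
lemma exists_fixed_point_of_isBarycenter [Nonempty X] (G : Subgroup (X ≃ᵢ X)) [Finite G]
    (hG : ∀ g ∈ G, ∀ a b, g (m a b) = m (g a) (g b))
    {B : (Fin (Nat.card G) → X) → X} (hB : IsBarycenter m B) :
    ∃ x : X, ∀ g ∈ G, g x = x := by
  obtain ⟨p⟩ := ‹Nonempty X›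
  let e := Finite.equivFin G
  let orbit : Fin (Nat.card G) → X := fun i => (e.symm i : X ≃ᵢ X) p
  refine ⟨B orbit, fun g hg => ?_⟩
  let π : Equiv.Perm (Fin (Nat.card G)) := (e.symm.trans (Equiv.mulLeft ⟨g, hg⟩)).trans e
  have h : g ∘ orbit = orbit ∘ π := by
    funext i
    simp [orbit, π]
  rw [← hB.equivariant g (hG g hg), h, hB.perm]

end Barycenter

section Bicombing

variable {X : Type*} [MetricSpace X] {σ : X → X → ℝ → X}

lemma IsConvexBicombing.conj (hσ : IsConvexBicombing σ) (g : X ≃ᵢ X) :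
    IsConvexBicombing fun x y t => g.symm (σ (g x) (g y) t) := by
  obtain ⟨hgeo, hrev, hcons, hconv⟩ := hσ
  refine ⟨fun x y => ?_, fun x y t ht => ?_, fun x y s hs t ht => ?_, fun x y x' y' => ?_⟩
  · obtain ⟨h0, h1, hd⟩ := hgeo (g x) (g y)
    refine ⟨by simp [h0], by simp [h1], fun s hs t ht => ?_⟩
    rw [g.symm.dist_eq, hd s hs t ht, g.dist_eq]
  · exact congrArg g.symm (hrev _ _ t ht)
  · simp [hcons (g x) (g y) s hs t ht]
  · simpa only [g.symm.dist_eq] using hconv (g x) (g y) (g x') (g y')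

lemma IsConvexBicombing.midpoint_comm (hσ : IsConvexBicombing σ) (x y : X) :
    σ x y (1 / 2) = σ y x (1 / 2) := by
  rw [hσ.2.1 x y (1 / 2) (by constructor <;> norm_num)]
  norm_num

lemma IsConvexBicombing.apply_self (hσ : IsConvexBicombing σ) (x : X) {t : ℝ}
    (ht : t ∈ Icc (0 : ℝ) 1) : σ x x t = x := by
  obtain ⟨h0, -, hd⟩ := hσ.1 x x
  have h := hd t ht 0 (by simp)
  rwa [dist_self, mul_zero, dist_eq_zero, h0] at h

lemma IsConvexBicombing.isConical (hσ : IsConvexBicombing σ) : IsConicalBicombing σ := by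
  intro x y x' y' t ht
  have h := (hσ.2.2.2 x y x' y').2 (left_mem_Icc.2 zero_le_one) (right_mem_Icc.2 zero_le_one)
    (sub_nonneg.2 ht.2) ht.1 (sub_add_cancel 1 t)
  simpa [(hσ.1 x y).1, (hσ.1 x y).2.1, (hσ.1 x' y').1, (hσ.1 x' y').2.1] using h

end Bicombing

/-- In a complete CUB metric space, every finite group of surjective isometries
has a global fixed point. -/
theorem finite_isometry_group_has_fixed_point {X : Type*} [MetricSpace X]
    [CompleteSpace X] [Nonempty X]
    (σ : X → X → ℝ → X) (hσ : IsConvexBicombing σ)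
    (huniq : ∀ τ : X → X → ℝ → X, IsConvexBicombing τ →
      ∀ x y : X, ∀ t ∈ Icc (0:ℝ) 1, τ x y t = σ x y t)
    (G : Subgroup (X ≃ᵢ X)) [Finite G] :
    ∃ x : X, ∀ g ∈ G, g x = x := by
  have half_mem : (1 / 2 : ℝ) ∈ Icc (0 : ℝ) 1 := by constructor <;> norm_num
  obtain ⟨B, hB⟩ := exists_isBarycenter (m := fun x y => σ x y (1 / 2)) hσ.midpoint_comm
    (fun x => hσ.apply_self x half_mem)
    (fun a b a' b' => by linarith [hσ.isConical a b a' b' (1 / 2) half_mem])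
    (Nat.card_pos (α := G))
  refine exists_fixed_point_of_isBarycenter G (fun g _ a b => ?_) hB
  simpa using (congrArg g (huniq _ (hσ.conj g) a b (1 / 2) half_mem)).symm
end

section
/- Let X be a metric space with a unique convex bicombing σ, and let G be a group acting on X by bijective isometries. If the fixed-point set F = {x ∈ X : ∀ g ∈ G, g·x = x} is nonempty, then F is σ-convex (i.e. σ(x,y,t) ∈ F for all x, y ∈ F and t ∈ [0,1]) and F, endowed with the induced metric, is contractible. -/
open Set

/-- The conjugate of a convex bicombing by an isometry of a group action is a convex bicombing. -/
theorem IsConvexBicombing.conj_smul {X : Type*} [MetricSpace X] {G : Type*} [Group G]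
    [MulAction G X] (hiso : ∀ g : G, Isometry (fun x : X => g • x))
    {σ : X → X → ℝ → X} (hσ : IsConvexBicombing σ) (g : G) :
    IsConvexBicombing (fun x y t => g⁻¹ • σ (g • x) (g • y) t) := by
  obtain ⟨hgeo, hrev, hcons, hconv⟩ := hσ
  have hdist (h : G) (a b : X) : dist (h • a) (h • b) = dist a b := (hiso h).dist_eq a b
  refine ⟨fun x y => ⟨?_, ?_, fun s hs t ht => ?_⟩, fun x y t ht => ?_,
    fun x y s hs t ht => ?_, fun x y x' y' => ?_⟩
  · simp [(hgeo _ _).1]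
  · simp [(hgeo _ _).2.1]
  · simp only [hdist]
    rw [(hgeo _ _).2.2 s hs t ht, hdist]
  · simp only
    rw [hrev _ _ t ht]
  · simp only [smul_inv_smul]
    rw [hcons _ _ s hs t ht]
  · simpa only [hdist] using hconv (g • x) (g • y) (g • x') (g • y')

/-- Combing lines of a convex bicombing with a common endpoint get no further apart. -/
theorem IsConvexBicombing.dist_le_of_right_eq {X : Type*} [MetricSpace X]
    {σ : X → X → ℝ → X} (hσ : IsConvexBicombing σ) (x x' p : X) {t : ℝ}
    (ht : t ∈ Icc (0:ℝ) 1) : dist (σ x p t) (σ x' p t) ≤ dist x x' := by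
  obtain ⟨hgeo, -, -, hconv⟩ := hσ
  have h := (hconv x p x' p).2 (left_mem_Icc.2 zero_le_one) (right_mem_Icc.2 zero_le_one)
    (sub_nonneg.2 ht.2) ht.1 (sub_add_cancel 1 t)
  simp only [smul_eq_mul, mul_zero, mul_one, zero_add, (hgeo _ _).1, (hgeo _ _).2.1,
    dist_self, add_zero] at h
  exact h.trans (mul_le_of_le_one_left dist_nonneg (by linarith [ht.1]))

/-- A nonempty subset that is closed under a convex bicombing is contractible. -/
theorem IsConvexBicombing.contractibleSpace {X : Type*} [MetricSpace X]
    {σ : X → X → ℝ → X} (hσ : IsConvexBicombing σ) {F : Set X} (hne : F.Nonempty)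
    (hF : ∀ x ∈ F, ∀ y ∈ F, ∀ t ∈ Icc (0:ℝ) 1, σ x y t ∈ F) : ContractibleSpace F := by
  obtain ⟨p, hp⟩ := hne
  have hgeo := hσ.1
  let H : unitInterval × F → F := fun q => ⟨σ q.2 p q.1, hF _ q.2.2 _ hp _ q.1.2⟩
  have hcont : Continuous H := by
    refine continuous_prod_of_continuous_lipschitzWith' H 1 (fun t => ?_) (fun x => ?_)
    · exact LipschitzWith.mk_one fun x x' => hσ.dist_le_of_right_eq x x' p t.2
    · refine (LipschitzWith.of_dist_le_mul (K := nndist (x : X) p) fun s t => ?_).continuous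
      change dist (σ x p s) (σ x p t) ≤ dist (x : X) p * dist (s : ℝ) t
      rw [(hgeo _ _).2.2 s s.2 t t.2, Real.dist_eq, mul_comm]
  rw [contractible_iff_id_nullhomotopic]
  exact ⟨⟨p, hp⟩, ⟨{ toFun := H
                     continuous_toFun := hcont
                     map_zero_left := fun x => Subtype.ext (hgeo x p).1
                     map_one_left := fun x => Subtype.ext (hgeo x p).2.1 }⟩⟩

/-- If a group acts by bijective isometries on a metric space with a unique convex
bicombing `σ`, and its fixed-point set is nonempty, then the fixed-point set is
`σ`-convex and contractible (with the induced metric). -/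
theorem fixedPointSet_convex_and_contractible {X : Type*} [MetricSpace X]
    {G : Type*} [Group G] [MulAction G X]
    (hiso : ∀ g : G, Isometry (fun x : X => g • x))
    (σ : X → X → ℝ → X) (hσ : IsConvexBicombing σ)
    (huniq : ∀ τ : X → X → ℝ → X, IsConvexBicombing τ →
      ∀ x y : X, ∀ t ∈ Icc (0:ℝ) 1, τ x y t = σ x y t)
    (F : Set X) (hF : F = {x : X | ∀ g : G, g • x = x}) (hne : F.Nonempty) :
    (∀ x ∈ F, ∀ y ∈ F, ∀ t ∈ Icc (0:ℝ) 1, σ x y t ∈ F) ∧ ContractibleSpace F := by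
  have hconv : ∀ x ∈ F, ∀ y ∈ F, ∀ t ∈ Icc (0:ℝ) 1, σ x y t ∈ F := by
    subst hF
    intro x hx y hy t ht g
    have h := huniq _ (hσ.conj_smul hiso g) x y t ht
    simp only [hx g, hy g] at h
    exact (inv_smul_eq_iff.1 h).symm
  exact ⟨hconv, hσ.contractibleSpace hne hconv⟩
end

section
/- Let L be a partial order equipped with a rank function rk : L → ℕ such that (i) a < b implies rk(a) < rk(b), and (ii) for every b ∈ L and every natural number n < rk(b) there exists b' ∈ L with b' < b and rk(b') = n. If L has no balanced bowtie, then any two elements c, d ∈ L with rk(c) = rk(d) have a greatest lower bound in L ∪ {0} (i.e. in WithBot L: either {c, d} has no lower bound in L, or it has a greatest lower bound in L). -/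
open Set

/-- A bowtie in a poset `L`: four elements `a, b < c, d` with no element between
`{a, b}` and `{c, d}`. -/
def Bowtie {L : Type*} [PartialOrder L] (a b c d : L) : Prop :=
  a < c ∧ a < d ∧ b < c ∧ b < d ∧ ¬ ∃ x : L, a ≤ x ∧ b ≤ x ∧ x ≤ c ∧ x ≤ d

/-- Without balanced bowties, a common lower bound of maximal rank of two distinct elements of
equal rank lies above every common lower bound. -/
theorem le_of_rank_maximal_of_no_balanced_bowtie {L : Type*} [PartialOrder L] {rk : L → ℕ}
    (hmono : ∀ a b : L, a < b → rk a < rk b)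
    (hgraded : ∀ b : L, ∀ n : ℕ, n < rk b → ∃ b' : L, b' < b ∧ rk b' = n)
    (hnb : ¬ ∃ a b c d : L, Bowtie a b c d ∧ rk a = rk b ∧ rk c = rk d)
    {c d : L} (hrk : rk c = rk d) (hne : c ≠ d) {z : L} (hzc : z ≤ c) (hzd : z ≤ d)
    (hmax : ∀ x : L, x ≤ c → x ≤ d → rk x ≤ rk z) (w : L) (hwc : w ≤ c) (hwd : w ≤ d) :
    w ≤ z := by
  have lt_both : ∀ x : L, x ≤ c → x ≤ d → x < c ∧ x < d := by
    intro x hxc hxd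
    refine ⟨hxc.lt_of_ne ?_, hxd.lt_of_ne ?_⟩
    · rintro rfl
      exact (hmono _ _ (hxd.lt_of_ne hne)).ne hrk
    · rintro rfl
      exact (hmono _ _ (hxc.lt_of_ne hne.symm)).ne hrk.symm
  induction hk : rk z - rk w using Nat.strong_induction_on generalizing w with
  | _ k ih =>
    obtain ⟨z', hz'z, hz'w⟩ : ∃ z', z' ≤ z ∧ rk z' = rk w := by
      rcases (hmax w hwc hwd).lt_or_eq with h | h
      · obtain ⟨z', hlt, hz'⟩ := hgraded z _ h
        exact ⟨z', hlt.le, hz'⟩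
      · exact ⟨z, le_rfl, h.symm⟩
    by_cases hx : ∃ x : L, z' ≤ x ∧ w ≤ x ∧ x ≤ c ∧ x ≤ d
    · obtain ⟨x, hz'x, hwx, hxc, hxd⟩ := hx
      rcases hwx.lt_or_eq with hlt | rfl
      · have := hmono _ _ hlt
        have := hmax x hxc hxd
        exact hwx.trans (ih _ (by omega) x hxc hxd rfl)
      · rcases hz'x.lt_or_eq with hlt | rfl
        · exact absurd hz'w (hmono _ _ hlt).ne
        · exact hz'z
    · obtain ⟨hz'c, hz'd⟩ := lt_both z' (hz'z.trans hzc) (hz'z.trans hzd)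
      obtain ⟨hwc', hwd'⟩ := lt_both w hwc hwd
      exact absurd ⟨z', w, c, d, ⟨hz'c, hz'd, hwc', hwd', hx⟩, hz'w, hrk⟩ hnb

/-- In a graded poset with no balanced bowtie, any two elements of equal rank
have a greatest lower bound in `L ∪ {0}`. -/
theorem meet_exists_of_no_balanced_bowtie {L : Type*} [PartialOrder L] (rk : L → ℕ)
    (hmono : ∀ a b : L, a < b → rk a < rk b)
    (hgraded : ∀ b : L, ∀ n : ℕ, n < rk b → ∃ b' : L, b' < b ∧ rk b' = n)
    (hnb : ¬ ∃ a b c d : L, Bowtie a b c d ∧ rk a = rk b ∧ rk c = rk d)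
    (c d : L) (hrk : rk c = rk d) :
    ∃ z : WithBot L, IsGLB {(c : WithBot L), (d : WithBot L)} z := by
  rcases eq_or_ne c d with rfl | hne
  · exact ⟨c, by simp⟩
  by_cases hlb : ∃ x : L, x ≤ c ∧ x ≤ d
  · have hbdd : BddAbove (rk '' {x | x ≤ c ∧ x ≤ d}) := by
      refine ⟨rk c, ?_⟩
      rintro _ ⟨x, ⟨hxc, -⟩, rfl⟩
      rcases hxc.lt_or_eq with h | rfl
      · exact (hmono _ _ h).le
      · exact le_rfl
    obtain ⟨z, ⟨hzc, hzd⟩, hz⟩ := Nat.sSup_mem (Set.Nonempty.image rk hlb) hbdd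
    have hmax : ∀ x : L, x ≤ c → x ≤ d → rk x ≤ rk z := fun x hxc hxd =>
      hz ▸ le_csSup hbdd ⟨x, ⟨hxc, hxd⟩, rfl⟩
    refine ⟨z, by simp [lowerBounds_insert, hzc, hzd], fun w hw => ?_⟩
    have hwc := hw (mem_insert _ _)
    have hwd := hw (mem_insert_of_mem _ rfl)
    induction w using WithBot.recBotCoe with
    | bot => exact bot_le
    | coe w =>
      exact WithBot.coe_le_coe.2 (le_of_rank_maximal_of_no_balanced_bowtie hmono hgraded hnb hrk
        hne hzc hzd hmax w (WithBot.coe_le_coe.1 hwc) (WithBot.coe_le_coe.1 hwd))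
  · refine ⟨⊥, fun _ _ => bot_le, fun w hw => ?_⟩
    have hwc := hw (mem_insert _ _)
    have hwd := hw (mem_insert_of_mem _ rfl)
    induction w using WithBot.recBotCoe with
    | bot => exact le_rfl
    | coe w => exact absurd ⟨w, WithBot.coe_le_coe.1 hwc, WithBot.coe_le_coe.1 hwd⟩ hlb
end

section
/- Let L be a partial order in which there is a uniform finite bound on the cardinality of chains. Then L has no bowtie if and only if every pair of elements of L having a common upper bound in L has a least upper bound in L, and every pair of elements of L having a common lower bound in L has a greatest lower bound in L (equivalently, L ∪ {0,1} = WithBot (WithTop L) is a lattice). -/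
open Set

theorem wellFoundedLT_of_card_chain_le {L : Type*} [PartialOrder L] {n : ℕ}
    (h : ∀ s : Finset L, IsChain (· ≤ ·) (s : Set L) → s.card ≤ n) : WellFoundedLT L := by
  refine ⟨wellFounded_iff_isEmpty_descending_chain.2 ⟨fun ⟨f, hf⟩ ↦ ?_⟩⟩
  have hf : StrictAnti f := strictAnti_nat_of_succ_lt hf
  have hcard := h ((Finset.range (n + 1)).map ⟨f, hf.injective⟩) <| by
    intro x hx y hy _
    simp only [Finset.coe_map, Set.mem_image] at hx hy
    obtain ⟨i, -, rfl⟩ := hx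
    obtain ⟨j, -, rfl⟩ := hy
    exact (le_total j i).imp (fun hij ↦ hf.antitone hij) (fun hij ↦ hf.antitone hij)
  simp at hcard

theorem exists_between_of_no_bowtie {L : Type*} [PartialOrder L]
    (h : ¬ ∃ a b c d : L, Bowtie a b c d) {a b c d : L}
    (hac : a ≤ c) (had : a ≤ d) (hbc : b ≤ c) (hbd : b ≤ d) :
    ∃ x : L, a ≤ x ∧ b ≤ x ∧ x ≤ c ∧ x ≤ d := by
  rcases hac.eq_or_lt with rfl | hac'
  · exact ⟨a, le_rfl, hbc, le_rfl, had⟩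
  rcases had.eq_or_lt with rfl | had'
  · exact ⟨a, le_rfl, hbd, hac, le_rfl⟩
  rcases hbc.eq_or_lt with rfl | hbc'
  · exact ⟨b, hac, le_rfl, le_rfl, hbd⟩
  rcases hbd.eq_or_lt with rfl | hbd'
  · exact ⟨b, had, le_rfl, hbc, le_rfl⟩
  by_contra hx
  exact h ⟨a, b, c, d, hac', had', hbc', hbd', hx⟩

theorem exists_isLUB_pair_of_no_bowtie {L : Type*} [PartialOrder L] [WellFoundedLT L]
    (h : ¬ ∃ a b c d : L, Bowtie a b c d) {a b : L} (hu : ∃ u : L, a ≤ u ∧ b ≤ u) :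
    ∃ z : L, IsLUB {a, b} z := by
  obtain ⟨z, ⟨haz, hbz⟩, hmin⟩ :=
    wellFounded_lt.has_min {u : L | a ≤ u ∧ b ≤ u} hu
  refine ⟨z, by simp [haz, hbz], fun w hw ↦ ?_⟩
  obtain ⟨x, hax, hbx, hxz, hxw⟩ := exists_between_of_no_bowtie h haz
    (hw (Set.mem_insert a _)) hbz (hw (Set.mem_insert_of_mem a rfl))
  rcases hxz.eq_or_lt with rfl | hlt
  · exact hxw
  · exact absurd hlt (hmin x ⟨hax, hbx⟩)

theorem no_bowtie_orderDual {L : Type*} [PartialOrder L]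
    (h : ¬ ∃ a b c d : L, Bowtie a b c d) : ¬ ∃ a b c d : Lᵒᵈ, Bowtie a b c d := by
  rintro ⟨a, b, c, d, hac, had, hbc, hbd, hx⟩
  exact h ⟨OrderDual.ofDual c, OrderDual.ofDual d, OrderDual.ofDual a, OrderDual.ofDual b,
    hac, hbc, had, hbd, fun ⟨x, h₁, h₂, h₃, h₄⟩ ↦ hx ⟨OrderDual.toDual x, h₃, h₄, h₁, h₂⟩⟩

/-- For a poset with a uniform bound on the cardinality of chains, having no
bowtie is equivalent to: every upperly bounded pair has a least upper bound and
every lowerly bounded pair has a greatest lower bound. -/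
theorem no_bowtie_iff_bounded_pairs_have_bounds {L : Type*} [PartialOrder L]
    (hchain : ∃ n : ℕ, ∀ s : Finset L, IsChain (· ≤ ·) (s : Set L) → s.card ≤ n) :
    (¬ ∃ a b c d : L, Bowtie a b c d) ↔
      ((∀ a b : L, (∃ u : L, a ≤ u ∧ b ≤ u) → ∃ z : L, IsLUB {a, b} z) ∧
       (∀ a b : L, (∃ l : L, l ≤ a ∧ l ≤ b) → ∃ z : L, IsGLB {a, b} z)) := by
  obtain ⟨n, hn⟩ := hchain
  constructor
  · intro h
    have : WellFoundedLT L := wellFoundedLT_of_card_chain_le hn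
    have : WellFoundedLT Lᵒᵈ := wellFoundedLT_of_card_chain_le (n := n) fun s hs ↦
      hn s hs.symm
    refine ⟨fun a b hu ↦ exists_isLUB_pair_of_no_bowtie h hu, fun a b hl ↦ ?_⟩
    exact exists_isLUB_pair_of_no_bowtie (no_bowtie_orderDual h)
      (a := OrderDual.toDual a) (b := OrderDual.toDual b) hl
  · rintro ⟨hsup, -⟩ ⟨a, b, c, d, hac, had, hbc, hbd, hx⟩
    obtain ⟨z, hz⟩ := hsup a b ⟨c, hac.le, hbc.le⟩
    exact hx ⟨z, hz.1 (Set.mem_insert a _), hz.1 (Set.mem_insert_of_mem a rfl),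
      hz.2 (by simp [hac.le, hbc.le]), hz.2 (by simp [had.le, hbd.le])⟩
end

section
/- Let X be a proper metric space (closed balls are compact) with a conical geodesic bicombing σ which is geodesically complete in the following sense: for all distinct x, y ∈ X there exists a σ-ray c : [0,∞) → X with c(0) = x and c(d(x,y)) = y. Fix x₀ ∈ X and let B be the set of Busemann functions β_c : X → ℝ, β_c(x) = lim_{t→∞} (d(x, c(t)) − t), taken over all σ-rays c with c(0) = x₀ (this limit exists since the expression is nonincreasing in t and bounded below by −d(x, x₀)). If B is finite with at most N elements, then X admits an isometric embedding into ℝ^N equipped with the supremum (ℓ^∞) metric. -/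
open Set

/-- A `σ`-ray: a unit-speed ray whose segments are combing lines of `σ`. -/
def IsSigmaRay {X : Type*} [MetricSpace X] (σ : X → X → ℝ → X) (c : ℝ → X) : Prop :=
  (∀ s t : ℝ, 0 ≤ s → 0 ≤ t → dist (c s) (c t) = |s - t|) ∧
  (∀ s t : ℝ, 0 ≤ s → s ≤ t → ∀ l ∈ Icc (0:ℝ) 1,
    σ (c s) (c t) l = c ((1 - l) * s + l * t))

open Filter Topology

section BusemannFunctions

variable {X : Type*} [MetricSpace X] {σ : X → X → ℝ → X} {c : ℝ → X} {β : X → ℝ}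

/-- `β` is the Busemann function of `c`. -/
def IsBusemannFunction (c : ℝ → X) (β : X → ℝ) : Prop :=
  ∀ x : X, Tendsto (fun t : ℝ => dist x (c t) - t) atTop (𝓝 (β x))

theorem IsSigmaRay.exists_isBusemannFunction (hc : IsSigmaRay σ c) :
    ∃ β : X → ℝ, IsBusemannFunction c β := by
  have hlim (x : X) : ∃ b : ℝ, Tendsto (fun t : ℝ => dist x (c t) - t) atTop (𝓝 b) := by
    have hanti : Antitone fun t : ℝ => dist x (c (max t 0)) - max t 0 := by
      intro s t hst
      have hmax : max s 0 ≤ max t 0 := max_le_max_right 0 hst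
      have hdist := hc.1 (max s 0) (max t 0) (le_max_right _ _) (le_max_right _ _)
      rw [abs_sub_comm, abs_of_nonneg (sub_nonneg.2 hmax)] at hdist
      have htri := dist_triangle x (c (max s 0)) (c (max t 0))
      dsimp only
      linarith
    have hbdd : BddBelow (range fun t : ℝ => dist x (c (max t 0)) - max t 0) := by
      refine ⟨-dist x (c 0), ?_⟩
      rintro _ ⟨t, rfl⟩
      have hdist := hc.1 0 (max t 0) le_rfl (le_max_right _ _)
      rw [zero_sub, abs_neg, abs_of_nonneg (le_max_right _ _)] at hdist
      have htri := dist_triangle_left (c 0) (c (max t 0)) x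
      dsimp only
      linarith
    refine ⟨_, (tendsto_atTop_ciInf hanti hbdd).congr' ?_⟩
    filter_upwards [eventually_ge_atTop 0] with t ht
    rw [max_eq_left ht]
  choose β hβ using hlim
  exact ⟨β, hβ⟩

namespace IsBusemannFunction

theorem sub_le_dist (hβ : IsBusemannFunction c β) (x y : X) : β x - β y ≤ dist x y := by
  refine le_of_tendsto ((hβ x).sub (hβ y)) (Eventually.of_forall fun t => ?_)
  have := dist_triangle x y (c t)
  linarith

theorem apply_ray (hβ : IsBusemannFunction c β) (hc : IsSigmaRay σ c) {s : ℝ} (hs : 0 ≤ s) :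
    β (c s) = -s := by
  refine tendsto_nhds_unique (hβ (c s)) (tendsto_const_nhds.congr' ?_)
  filter_upwards [eventually_ge_atTop s] with t ht
  rw [hc.1 s t hs (hs.trans ht), abs_sub_comm, abs_of_nonneg (sub_nonneg.2 ht)]
  ring

/-- Busemann functions are convex along the lines of a conical bicombing. -/
theorem apply_combing_le (hβ : IsBusemannFunction c β) (hgeo : IsGeodesicBicombing σ)
    (hconical : IsConicalBicombing σ) (x y : X) {l : ℝ} (hl : l ∈ Icc (0 : ℝ) 1) :
    β (σ x y l) ≤ (1 - l) * β x + l * β y := by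
  refine le_of_tendsto_of_tendsto' (hβ _) (((hβ x).const_mul (1 - l)).add ((hβ y).const_mul l))
    fun t => ?_
  have hconst : σ (c t) (c t) l = c t := by
    have h := (hgeo (c t) (c t)).2.2 l hl 0 (left_mem_Icc.2 zero_le_one)
    rwa [dist_self, mul_zero, dist_eq_zero, (hgeo (c t) (c t)).1] at h
  have h := hconical x y (c t) (c t) l hl
  rw [hconst] at h
  linarith

/-- If a Busemann function stays within a bounded distance of slope `-1` along a `σ`-ray, at
arbitrarily large times, then convexity forces it to have slope exactly `-1`. -/
theorem le_sub_of_frequently (hβ : IsBusemannFunction c β) (hgeo : IsGeodesicBicombing σ)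
    (hconical : IsConicalBicombing σ) {r : ℝ → X} (hr : IsSigmaRay σ r) {D : ℝ}
    (hfreq : ∃ᶠ n : ℕ in atTop, β (r n) ≤ -n + D) {s : ℝ} (hs : 0 ≤ s) :
    β (r s) ≤ β (r 0) - s := by
  have hlim : Tendsto (fun n : ℕ => (1 - s / n) * β (r 0) + (-s + s / n * D)) atTop
      (𝓝 ((1 - 0) * β (r 0) + (-s + 0 * D))) := by
    have hdiv := tendsto_const_div_atTop_nhds_zero_nat s
    exact ((hdiv.const_sub 1).mul_const _).add ((hdiv.mul_const D).const_add _)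
  have hle : ∃ᶠ n : ℕ in atTop, β (r s) ≤ (1 - s / n) * β (r 0) + (-s + s / n * D) := by
    refine (hfreq.and_eventually ((eventually_gt_atTop 0).and
      (eventually_ge_atTop ⌈s⌉₊))).mono ?_
    rintro n ⟨hn, hpos, hsn⟩
    have hpos' : (0 : ℝ) < n := Nat.cast_pos.2 hpos
    have hl : s / n ∈ Icc (0 : ℝ) 1 :=
      ⟨div_nonneg hs hpos'.le, (div_le_one hpos').2 (Nat.ceil_le.1 hsn)⟩
    have hconv := hβ.apply_combing_le hgeo hconical (r 0) (r n) hl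
    rw [hr.2 0 n le_rfl hpos'.le _ hl, mul_zero, zero_add, div_mul_cancel₀ s hpos'.ne'] at hconv
    have hmul := mul_le_mul_of_nonneg_left hn hl.1
    have hcancel : s / n * (-n + D) = -s + s / n * D := by field_simp
    linarith
  have := ge_of_tendsto_of_frequently hlim hle
  linarith

end IsBusemannFunction

/-- If only finitely many Busemann functions arise from `σ`-rays issuing at `x₀`, then they
detect every distance. -/
theorem exists_isBusemannFunction_sub_eq_dist (hgeo : IsGeodesicBicombing σ)
    (hconical : IsConicalBicombing σ)
    (hcomplete : ∀ x y : X, x ≠ y → ∃ c : ℝ → X, IsSigmaRay σ c ∧ c 0 = x ∧ c (dist x y) = y)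
    {x₀ : X}
    (hfin : {β : X → ℝ | ∃ c, IsSigmaRay σ c ∧ c 0 = x₀ ∧ IsBusemannFunction c β}.Finite)
    {x y : X} (hxy : x ≠ y) :
    ∃ c β, IsSigmaRay σ c ∧ c 0 = x₀ ∧ IsBusemannFunction c β ∧ β x - β y = dist x y := by
  obtain ⟨r, hr, hr0, hry⟩ := hcomplete x y hxy
  have hbound (n : ℕ) : -dist x₀ (r n) ≤ -n + dist x₀ x := by
    have hdist := hr.1 0 n le_rfl n.cast_nonneg
    rw [hr0, zero_sub, abs_neg, Nat.abs_cast] at hdist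
    have := dist_triangle_left x (r n) x₀
    linarith
  have hex : ∃ᶠ n : ℕ in atTop,
      ∃ β ∈ {β : X → ℝ | ∃ c, IsSigmaRay σ c ∧ c 0 = x₀ ∧ IsBusemannFunction c β},
        β (r n) ≤ -n + dist x₀ x := by
    refine Eventually.frequently ?_
    filter_upwards [eventually_gt_atTop ⌈dist x₀ x⌉₊] with n hn
    have hne : x₀ ≠ r n := by
      intro h
      have := hbound n
      rw [← h, dist_self] at this
      have := Nat.lt_of_ceil_lt hn
      linarith
    obtain ⟨c, hc, hc0, hcn⟩ := hcomplete x₀ (r n) hne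
    obtain ⟨β, hβ⟩ := hc.exists_isBusemannFunction
    refine ⟨β, ⟨c, hc, hc0, hβ⟩, ?_⟩
    have happly := hβ.apply_ray hc (dist_nonneg (x := x₀) (y := r n))
    rw [hcn] at happly
    exact happly.trans_le (hbound n)
  have hpigeon : ∃ β ∈ {β : X → ℝ | ∃ c, IsSigmaRay σ c ∧ c 0 = x₀ ∧ IsBusemannFunction c β},
      ∃ᶠ n : ℕ in atTop, β (r n) ≤ -n + dist x₀ x := by
    by_contra! h
    refine hex ?_
    filter_upwards [hfin.eventually_all.2 h] with n hn
    rintro ⟨β, hβ, hle⟩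
    exact (hn β hβ).not_ge hle
  obtain ⟨β, ⟨c, hc, hc0, hβ⟩, hfreq⟩ := hpigeon
  refine ⟨c, β, hc, hc0, hβ, le_antisymm (hβ.sub_le_dist x y) ?_⟩
  have := hβ.le_sub_of_frequently hgeo hconical hr hfreq (dist_nonneg (x := x) (y := y))
  rw [hry, hr0] at this
  linarith

end BusemannFunctions

/-- A family of at most `N` functions that are `1`-Lipschitz and detect all distances embeds the
space isometrically into `ℝ^N` with the supremum metric. -/
theorem exists_isometry_pi_of_finite {X : Type*} [MetricSpace X] {B : Set (X → ℝ)} {N : ℕ}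
    (hfin : B.Finite) (hcard : B.ncard ≤ N) (hlip : ∀ β ∈ B, ∀ x y, β x - β y ≤ dist x y)
    (hsep : ∀ x y, x ≠ y → ∃ β ∈ B, β x - β y = dist x y) :
    ∃ f : X → (Fin N → ℝ), Isometry f := by
  have := hfin.to_subtype
  let φ : B → Fin N := fun β => Fin.castLE hcard (Finite.equivFin B β)
  have hφ : Function.Injective φ :=
    (Fin.castLE_injective hcard).comp (Finite.equivFin B).injective
  let f : Fin N → X → ℝ := Function.extend φ Subtype.val 0
  refine ⟨fun x i => f i x, Isometry.of_dist_eq fun x y => le_antisymm ?_ ?_⟩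
  · refine (dist_pi_le_iff dist_nonneg).2 fun i => ?_
    by_cases hi : ∃ β, φ β = i
    · obtain ⟨β, rfl⟩ := hi
      simp only [f, hφ.extend_apply, Real.dist_eq]
      exact abs_sub_le_iff.2 ⟨hlip β β.2 x y, (hlip β β.2 y x).trans_eq (dist_comm y x)⟩
    · simp [f, Function.extend_apply' _ _ _ hi]
  · rcases eq_or_ne x y with rfl | hxy
    · simp
    obtain ⟨β, hβ, heq⟩ := hsep x y hxy
    refine le_trans ?_ (dist_le_pi_dist _ _ (φ ⟨β, hβ⟩))
    simp only [f, hφ.extend_apply, Real.dist_eq]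
    exact heq.symm.le.trans (le_abs_self _)

/-- A proper metric space with a geodesically complete conical geodesic bicombing,
having at most `N` Busemann functions of `σ`-rays from a basepoint, embeds
isometrically into `ℝ^N` with the supremum metric. -/
theorem isometric_embedding_of_finitely_many_busemann_points {X : Type*}
    [MetricSpace X] [ProperSpace X]
    (σ : X → X → ℝ → X) (hgeo : IsGeodesicBicombing σ) (hconical : IsConicalBicombing σ)
    (hcomplete : ∀ x y : X, x ≠ y → ∃ c : ℝ → X, IsSigmaRay σ c ∧ c 0 = x ∧ c (dist x y) = y)
    (x₀ : X) (N : ℕ) (B : Set (X → ℝ))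
    (hB : B = {β : X → ℝ | ∃ c : ℝ → X, IsSigmaRay σ c ∧ c 0 = x₀ ∧
      ∀ x : X, Filter.Tendsto (fun t : ℝ => dist x (c t) - t) Filter.atTop (nhds (β x))})
    (hfin : B.Finite) (hcard : B.ncard ≤ N) :
    ∃ f : X → (Fin N → ℝ), Isometry f := by
  subst hB
  refine exists_isometry_pi_of_finite hfin hcard ?_ fun x y hxy => ?_
  · rintro β ⟨c, -, -, hβ⟩ x y
    exact IsBusemannFunction.sub_le_dist hβ x y
  · obtain ⟨c, β, hc, hc0, hβ, heq⟩ :=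
      exists_isBusemannFunction_sub_eq_dist hgeo hconical hcomplete hfin hxy
    exact ⟨β, ⟨c, hc, hc0, hβ⟩, heq⟩
end

section
/- Let V be a finite-dimensional real normed vector space whose closed unit ball is a polytope (the convex hull of a finite set of points). For every v ∈ V with ‖v‖ = 1 and every x ∈ V, the limit ξ_v(x) = lim_{t→∞} (‖x − t·v‖ − t) exists. Moreover, the set of functions {ξ_v : V → ℝ | v ∈ V, ‖v‖ = 1} is finite; i.e. the affine half-lines issued from the origin correspond to only finitely many Busemann functions. -/
open Set Filter

/-- If the unit ball of a real normed space is the convex hull of a finite set, then the unit ball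
of its dual has finitely many extreme points. -/
theorem finite_extremePoints_closedBall_dual {V : Type*}
    [NormedAddCommGroup V] [NormedSpace ℝ V] {s : Finset V}
    (hs : Metric.closedBall (0 : V) 1 = convexHull ℝ (s : Set V)) :
    (extremePoints ℝ (Metric.closedBall (0 : StrongDual ℝ V) 1)).Finite := by
  classical
  have mem_ball (f : StrongDual ℝ V) :
      f ∈ Metric.closedBall (0 : StrongDual ℝ V) 1 ↔ ∀ p ∈ s, f p ≤ 1 := by
    rw [mem_closedBall_zero_iff]
    constructor
    · intro hf p hp
      have hp1 : ‖p‖ ≤ 1 := by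
        rw [← mem_closedBall_zero_iff, hs]
        exact subset_convexHull ℝ _ hp
      exact (le_abs_self _).trans (f.unit_le_opNorm p hp1 |>.trans hf)
    · intro hf
      have hle : ∀ x : V, ‖x‖ ≤ 1 → f x ≤ 1 := by
        intro x hx
        rw [← mem_closedBall_zero_iff, hs] at hx
        exact convexHull_min (t := {y | f y ≤ 1}) (fun p hp ↦ hf p hp)
          (convex_halfSpace_le f.isLinear 1) hx
      refine f.opNorm_le_of_unit_norm zero_le_one fun x hx ↦ ?_
      rw [Real.norm_eq_abs, abs_le']
      exact ⟨hle x hx.le, by simpa using hle (-x) (by simp [hx])⟩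
  refine Set.Finite.of_finite_image (f := fun f ↦ s.filter fun p ↦ f p = 1)
    (s.powerset.finite_toSet.subset ?_) ?_
  · rintro _ ⟨f, -, rfl⟩
    exact Finset.mem_coe.2 (Finset.mem_powerset.2 (Finset.filter_subset _ _))
  · intro f hf g hg hfg
    have hact : ∀ p ∈ s, f p = 1 → g p = 1 := by
      intro p hp h1
      have : p ∈ s.filter fun p ↦ g p = 1 := by
        have hmem : p ∈ s.filter fun p ↦ f p = 1 := by simp [hp, h1]
        simpa only [← hfg] using hmem
      exact (Finset.mem_filter.1 this).2
    have hf1 := (mem_ball f).1 hf.1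
    -- Extending the segment from `g` to `f` slightly beyond `f` stays inside the ball.
    obtain ⟨ε, hε, hε0⟩ : ∃ ε : ℝ, (∀ p ∈ s, (f + ε • (f - g)) p ≤ 1) ∧ 0 < ε := by
      have hev : ∀ᶠ ε : ℝ in nhdsWithin 0 (Ioi 0), ∀ p ∈ s, (f + ε • (f - g)) p ≤ 1 := by
        rw [Filter.eventually_all_finset]
        intro p hp
        rcases (hf1 p hp).eq_or_lt with h1 | h1
        · exact Eventually.of_forall fun ε ↦ by simp [h1, hact p hp h1]
        · have hcont : Continuous fun ε : ℝ ↦ (f + ε • (f - g)) p := by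
            simp only [add_apply, smul_apply]
            fun_prop
          have hlt := hcont.continuousAt.eventually_lt (x₀ := 0) continuousAt_const
            (by simpa using h1)
          exact (hlt.filter_mono nhdsWithin_le_nhds).mono fun _ h ↦ h.le
      exact (hev.and self_mem_nhdsWithin).exists
    have hseg : f ∈ openSegment ℝ g (f + ε • (f - g)) := by
      refine ⟨ε / (1 + ε), 1 / (1 + ε), by positivity, by positivity, by field_simp; ring, ?_⟩
      ext x
      simp only [add_apply, smul_apply,
        sub_apply, smul_eq_mul]
      field_simp
      ring
    exact (hf.2 hg.1 ((mem_ball _).2 hε) hseg).symm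

/-- A polyhedral norm is the maximum of finitely many linear functionals. -/
theorem exists_finset_dual_norm_isGreatest {V : Type*}
    [NormedAddCommGroup V] [NormedSpace ℝ V] [FiniteDimensional ℝ V] {s : Finset V}
    (hs : Metric.closedBall (0 : V) 1 = convexHull ℝ (s : Set V)) :
    ∃ F : Finset (StrongDual ℝ V), ∀ x : V,
      IsGreatest ((fun f : StrongDual ℝ V ↦ f x) '' (F : Set (StrongDual ℝ V))) ‖x‖ := by
  have hfin := finite_extremePoints_closedBall_dual hs
  have hF : convexHull ℝ (hfin.toFinset : Set (StrongDual ℝ V)) = Metric.closedBall 0 1 := by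
    have : ProperSpace (StrongDual ℝ V) := FiniteDimensional.proper_real _
    rw [hfin.coe_toFinset]
    exact (hfin.isCompact_convexHull ℝ).isClosed.closure_eq.symm.trans
      (closure_convexHull_extremePoints (isCompact_closedBall 0 1) (convex_closedBall 0 1))
  have hle : ∀ x : V, ∀ f ∈ hfin.toFinset, f x ≤ ‖x‖ := by
    intro x f hf
    have hf1 : ‖f‖ ≤ 1 := by
      rw [← mem_closedBall_zero_iff, ← hF]
      exact subset_convexHull ℝ _ hf
    calc f x ≤ ‖f x‖ := le_abs_self _
      _ ≤ 1 * ‖x‖ := f.le_of_opNorm_le hf1 x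
      _ = ‖x‖ := one_mul _
  refine ⟨hfin.toFinset, fun x ↦ ⟨?_, by rintro _ ⟨f, hf, rfl⟩; exact hle x f hf⟩⟩
  obtain ⟨g, hg, hgx⟩ := exists_dual_vector'' ℝ x
  have hgF : g ∈ convexHull ℝ (hfin.toFinset : Set (StrongDual ℝ V)) := by
    rwa [hF, mem_closedBall_zero_iff]
  have hconv : ConvexOn ℝ univ fun f : StrongDual ℝ V ↦ f x :=
    ⟨convex_univ, fun f _ g _ a b _ _ _ ↦ by simp⟩
  obtain ⟨f, hf, hgf⟩ := hconv.exists_ge_of_mem_convexHull (subset_univ _) hgF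
  refine ⟨f, hf, (hle x f hf).antisymm ?_⟩
  simpa [hgx] using hgf

/-- If a norm is the maximum of a finite set `F` of functionals, the Busemann function of the
half-line spanned by `v` is the maximum of those `f ∈ F` with `f v = -1`. -/
theorem tendsto_busemann_of_norm_isGreatest {V : Type*}
    [NormedAddCommGroup V] [NormedSpace ℝ V] {F A : Finset (StrongDual ℝ V)}
    (hF : ∀ x : V, IsGreatest ((fun f : StrongDual ℝ V ↦ f x) '' (F : Set (StrongDual ℝ V))) ‖x‖)
    {v : V} (hv : ‖v‖ = 1)
    (hA : ∀ f, f ∈ A ↔ f ∈ F ∧ f v = -1) (hne : A.Nonempty) (x : V) :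
    Tendsto (fun t : ℝ ↦ ‖x - t • v‖ - t) atTop (nhds (A.sup' hne fun f ↦ f x)) := by
  refine tendsto_const_nhds.congr' ?_
  have hev : ∀ᶠ t : ℝ in atTop, ∀ f ∈ F, f (x - t • v) - t ≤ A.sup' hne fun f ↦ f x := by
    rw [Filter.eventually_all_finset]
    intro f hf
    have hfv : -1 ≤ f v := by
      have := (hF (-v)).2 ⟨f, hf, rfl⟩
      simp only [map_neg, norm_neg, hv] at this
      linarith
    rcases hfv.eq_or_lt with h1 | h1
    · refine Eventually.of_forall fun t ↦ ?_
      have := A.le_sup' (fun f ↦ f x) ((hA f).2 ⟨hf, h1.symm⟩)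
      simp only [map_sub, map_smul, smul_eq_mul, ← h1]
      linarith
    · have hlim : Tendsto (fun t : ℝ ↦ (1 + f v) * t) atTop atTop :=
        tendsto_id.const_mul_atTop (by linarith)
      filter_upwards [hlim.eventually_ge_atTop (f x - A.sup' hne fun f ↦ f x)] with t ht
      simp only [map_sub, map_smul, smul_eq_mul]
      linarith
  filter_upwards [hev] with t ht
  refine le_antisymm (A.sup'_le hne _ fun f hf ↦ ?_) ?_
  · obtain ⟨hfF, hfv⟩ := (hA f).1 hf
    have := (hF (x - t • v)).2 ⟨f, hfF, rfl⟩
    simp only [map_sub, map_smul, hfv, smul_eq_mul] at this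
    linarith
  · obtain ⟨f, hf, hfx⟩ := (hF (x - t • v)).1
    rw [← hfx]
    exact ht f hf

/-- In a finite-dimensional real normed space with polyhedral norm, the Busemann
function of every affine half-line from the origin exists, and there are only
finitely many such Busemann functions. -/
theorem busemann_functions_of_polyhedral_norm_finite {V : Type*}
    [NormedAddCommGroup V] [NormedSpace ℝ V] [FiniteDimensional ℝ V]
    (hpoly : ∃ s : Finset V, Metric.closedBall (0 : V) 1 = convexHull ℝ (s : Set V)) :
    (∀ v : V, ‖v‖ = 1 → ∀ x : V, ∃ l : ℝ,
        Tendsto (fun t : ℝ => ‖x - t • v‖ - t) atTop (nhds l)) ∧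
    {ξ : V → ℝ | ∃ v : V, ‖v‖ = 1 ∧ ∀ x : V,
        Tendsto (fun t : ℝ => ‖x - t • v‖ - t) atTop (nhds (ξ x))}.Finite := by
  classical
  obtain ⟨s, hs⟩ := hpoly
  obtain ⟨F, hF⟩ := exists_finset_dual_norm_isGreatest hs
  have hmain : ∀ v : V, ‖v‖ = 1 → ∃ A ∈ F.powerset, ∃ hne : A.Nonempty, ∀ x : V,
      Tendsto (fun t : ℝ ↦ ‖x - t • v‖ - t) atTop (nhds (A.sup' hne fun f ↦ f x)) := by
    intro v hv
    obtain ⟨f, hf, hfv⟩ := (hF (-v)).1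
    have hfv' : f v = -1 := by
      simp only [map_neg, norm_neg, hv] at hfv
      linarith
    exact ⟨F.filter fun f ↦ f v = -1, by simp, ⟨f, Finset.mem_filter.2 ⟨hf, hfv'⟩⟩,
      tendsto_busemann_of_norm_isGreatest hF hv (by simp) _⟩
  refine ⟨fun v hv x ↦ ?_, ?_⟩
  · obtain ⟨A, -, hne, hlim⟩ := hmain v hv
    exact ⟨_, hlim x⟩
  · refine (F.powerset.finite_toSet.image fun A x ↦
      if hne : A.Nonempty then A.sup' hne fun f ↦ f x else 0).subset ?_
    rintro ξ ⟨v, hv, hξ⟩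
    obtain ⟨A, hAF, hne, hlim⟩ := hmain v hv
    refine ⟨A, hAF, funext fun x ↦ ?_⟩
    simpa only [dif_pos hne] using tendsto_nhds_unique (hlim x) (hξ x)
end
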